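/- (Existence of a global minimizer of the Huber objective.) Let τ > 0, let A be a real N×p matrix whose associated linear map θ ↦ Aθ is injective, and let b ∈ ℝ^N. Then the Huber objective f(θ) = Σ_{i=1}^N ρ_τ(b_i − (Aθ)_i) attains its infimum: there exists θ* ∈ ℝ^p with f(θ*) ≤ f(θ) for all θ ∈ ℝ^p. -/

import Mathlib

/-- The Huber loss with threshold `τ`. -/
noncomputable def huber (τ r : ℝ) : ℝ := if |r| ≤ τ then r ^ 2 / 2 else τ * (|r| - τ / 2)

theorem continuous_huber (τ : ℝ) : Continuous (huber τ) := by
  unfold huber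
  refine Continuous.if_le (by fun_prop) (by fun_prop) (by fun_prop) (by fun_prop) ?_
  intro r hr
  rw [← sq_abs, hr]
  ring

theorem le_huber (τ r : ℝ) : τ * (|r| - τ / 2) ≤ huber τ r := by
  unfold huber
  split_ifs
  · rw [← sq_abs]
    nlinarith [sq_nonneg (|r| - τ)]
  · exact le_rfl

theorem le_sum_huber {ι : Type*} [Fintype ι] {τ : ℝ} (hτ : 0 ≤ τ) (r : ι → ℝ) :
    τ * ‖r‖ - Fintype.card ι * (τ ^ 2 / 2) ≤ ∑ i, huber τ (r i) := by
  have hnorm : ‖r‖ ≤ ∑ i, |r i| :=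
    (pi_norm_le_iff_of_nonneg (Finset.sum_nonneg fun i _ => abs_nonneg (r i))).2 fun i =>
      Finset.single_le_sum (f := fun i => |r i|) (fun j _ => abs_nonneg (r j)) (Finset.mem_univ i)
  calc τ * ‖r‖ - Fintype.card ι * (τ ^ 2 / 2)
      ≤ τ * ∑ i, |r i| - Fintype.card ι * (τ ^ 2 / 2) := by gcongr
    _ = ∑ i, τ * (|r i| - τ / 2) := by
      simp only [mul_sub, Finset.sum_sub_distrib, Finset.mul_sum, Finset.sum_const,
        Finset.card_univ, nsmul_eq_mul]
      ring
    _ ≤ ∑ i, huber τ (r i) := Finset.sum_le_sum fun i _ => le_huber τ (r i)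

theorem tendsto_sum_huber_cocompact {ι : Type*} [Fintype ι] {τ : ℝ} (hτ : 0 < τ) :
    Filter.Tendsto (fun r : ι → ℝ => ∑ i, huber τ (r i)) (Filter.cocompact _) Filter.atTop := by
  refine Filter.tendsto_atTop_mono (le_sum_huber hτ.le) ?_
  simp only [sub_eq_add_neg]
  exact Filter.tendsto_atTop_add_const_right _ _
    ((tendsto_norm_cocompact_atTop (E := ι → ℝ)).const_mul_atTop hτ)

/-- Existence of a global minimizer of the Huber objective when the linear map
`θ ↦ Aθ` is injective. -/
theorem huber_objective_exists_min {N p : ℕ} (τ : ℝ) (hτ : 0 < τ)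
    (A : Matrix (Fin N) (Fin p) ℝ) (hA : Function.Injective A.mulVec) (b : Fin N → ℝ) :
    ∃ θs : Fin p → ℝ, ∀ θ : Fin p → ℝ,
      ∑ i, huber τ (b i - A.mulVec θs i) ≤ ∑ i, huber τ (b i - A.mulVec θ i) := by
  have hemb : Topology.IsClosedEmbedding A.mulVec :=
    LinearMap.isClosedEmbedding_of_injective (f := A.mulVecLin) (LinearMap.ker_eq_bot.2 hA)
  have hres : Topology.IsClosedEmbedding fun θ => b - A.mulVec θ :=
    (Homeomorph.subLeft b).isClosedEmbedding.comp hemb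
  have hcont : Continuous fun r : Fin N → ℝ => ∑ i, huber τ (r i) :=
    continuous_finsetSum _ fun i _ => (continuous_huber τ).comp (continuous_apply i)
  exact (hcont.comp hres.continuous).exists_forall_le
    ((tendsto_sum_huber_cocompact hτ).comp hres.tendsto_cocompact)
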